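/- Polynomial for up-scaling block-encoded operators: There exists a constant C > 0 such that for all real numbers α, β with 1 < β < α and every ε' ∈ (0, 1/2), there is an odd polynomial R with real coefficients of degree at most C·(α/(β − 1))·(1 + ln(1/ε')) satisfying: |R(x)| ≤ 1 for all x ∈ [−1, 1], and |R(x) − (α/β)·x| ≤ ε'/β for all x ∈ [−1/α, 1/α]. -/

import Mathlib

open Polynomial Real intervalIntegral in
/-- Convolving a trigonometric polynomial `P (cos t)` with an even `2π`-periodic function
`g (cos t)` gives a polynomial in `cos θ` whose degree does not exceed that of `P`. -/
theorem exists_polynomial_eval_cos_eq_convolution (P : ℝ[X]) {g : ℝ → ℝ} (hg : Continuous g) :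
    ∃ Q : ℝ[X], Q.natDegree ≤ P.natDegree ∧
      ∀ θ : ℝ, Q.eval (cos θ) = ∫ t in (-π)..π, P.eval (cos t) * g (cos (θ - t)) := by
  have hT (k : ℕ) (θ : ℝ) :
      (∫ t in (-π)..π, (Chebyshev.T ℝ k).eval (cos t) * g (cos (θ - t))) =
        (∫ t in (-π)..π, cos (k * t) * g (cos t)) * (Chebyshev.T ℝ k).eval (cos θ) := by
    have hsin : (∫ t in (-π)..π, sin (k * t) * g (cos t)) = 0 := by
      have h := integral_comp_neg (a := -π) (b := π) (fun t => sin (k * t) * g (cos t))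
      simp only [mul_neg, sin_neg, cos_neg, neg_mul, neg_neg, integral_neg] at h
      linarith
    have hper : Function.Periodic (fun t => cos (k * (θ - t)) * g (cos t)) (2 * π) := by
      intro t
      have h1 : (k : ℝ) * (θ - (t + 2 * π)) = k * (θ - t) - k * (2 * π) := by ring
      simp only [h1, cos_sub_nat_mul_two_pi, cos_add_two_pi]
    have hshift : (∫ t in (-π)..π, cos (k * t) * g (cos (θ - t))) =
        ∫ t in (-π)..π, cos (k * (θ - t)) * g (cos t) := by
      have h := integral_comp_sub_left (a := -π) (b := π)
        (fun t => cos (k * (θ - t)) * g (cos t)) θ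
      simp only [sub_sub_cancel] at h
      rw [h]
      have h2 := hper.intervalIntegral_add_eq (θ - π) (-π)
      rw [show θ - π + 2 * π = θ - -π by ring, show -π + 2 * π = π by ring] at h2
      exact h2
    simp only [Chebyshev.T_real_cos, Int.cast_natCast]
    rw [hshift]
    have hexp (t : ℝ) : cos (k * (θ - t)) * g (cos t) =
        cos (k * θ) * (cos (k * t) * g (cos t)) + sin (k * θ) * (sin (k * t) * g (cos t)) := by
      rw [mul_sub, cos_sub]; ring
    simp only [hexp]
    rw [integral_add (Continuous.intervalIntegrable (by fun_prop) _ _)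
      (Continuous.intervalIntegrable (by fun_prop) _ _), integral_const_mul, integral_const_mul,
      hsin]
    ring
  have hmem : P ∈ Submodule.span ℝ (Chebyshev.chebyshevTsequence ℝ '' Set.Iic P.natDegree) := by
    rw [Polynomial.Sequence.span_degreeLE _ (by simp)]
    exact mem_degreeLE.2 degree_le_natDegree
  generalize P.natDegree = N at hmem
  induction hmem using Submodule.span_induction with
  | mem p hp =>
    obtain ⟨k, hk, rfl⟩ := hp
    refine ⟨C (∫ t in (-π)..π, cos (k * t) * g (cos t)) * Chebyshev.T ℝ k, ?_, fun θ => ?_⟩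
    · refine (natDegree_C_mul_le _ _).trans ?_
      simpa using hk
    · rw [eval_C_mul, ← hT]
      rfl
  | zero => exact ⟨0, by simp, by simp⟩
  | add p q _ _ hp hq =>
    obtain ⟨Q₁, h₁, e₁⟩ := hp
    obtain ⟨Q₂, h₂, e₂⟩ := hq
    refine ⟨Q₁ + Q₂, (natDegree_add_le _ _).trans (max_le h₁ h₂), fun θ => ?_⟩
    rw [eval_add, e₁, e₂, ← integral_add (Continuous.intervalIntegrable (by fun_prop) _ _)
      (Continuous.intervalIntegrable (by fun_prop) _ _)]
    simp only [eval_add, add_mul]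
  | smul c p _ hp =>
    obtain ⟨Q, h, e⟩ := hp
    refine ⟨c • Q, (natDegree_smul_le _ _).trans h, fun θ => ?_⟩
    rw [eval_smul, e, smul_eq_mul, ← integral_const_mul]
    simp only [eval_smul, smul_eq_mul, mul_assoc]

open Real intervalIntegral in
theorem integral_sq_div_sq_add_sq_le {w : ℝ} (hw : 0 < w) (a b : ℝ) :
    ∫ t in a..b, w ^ 2 / (w ^ 2 + t ^ 2) ≤ π * w := by
  have h (t : ℝ) : w ^ 2 / (w ^ 2 + t ^ 2) = 1 / (1 + (t / w) ^ 2) := by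
    field_simp
  simp only [h]
  rw [integral_comp_div (fun x => 1 / (1 + x ^ 2)) hw.ne', integral_one_div_one_add_sq, smul_eq_mul,
    mul_comm]
  gcongr
  linarith [arctan_lt_pi_div_two (b / w), neg_pi_div_two_lt_arctan (a / w)]

open Polynomial Real intervalIntegral in
/-- A Jackson-type kernel: a power of a Fejér kernel, concentrated on `|t| ≤ π² / n`, with a
majorant `T` of its tails. -/
theorem exists_jackson_kernel {n m : ℕ} (hn : 0 < n) (hm : 2 ≤ m) :
    ∃ (P : ℝ[X]) (T : ℝ → ℝ), P.natDegree ≤ 2 * n * m ∧ Continuous T ∧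
      (∀ t, 0 ≤ P.eval (cos t)) ∧ (∀ t, 0 ≤ T t) ∧
      (∀ t, |t| ≤ π → π ^ 2 / n < |t| → P.eval (cos t) ≤ T t) ∧
      (∀ t, |t| ≤ π → π ^ 2 / n < |t| → P.eval (cos t) * t ^ 2 ≤ (π ^ 2 / n) ^ 2 * T t) ∧
      0 < ∫ t in (-π)..π, P.eval (cos t) ∧
      ∫ t in (-π)..π, T t ≤ 2 * π ^ 2 / 16 ^ m * ∫ t in (-π)..π, P.eval (cos t) := by
  have hn' : (0 : ℝ) < n := by exact_mod_cast hn
  have hπ := pi_pos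
  set w : ℝ := π ^ 2 / n with hw_def
  have hw : 0 < w := by positivity
  set ρ : ℝ := 1 / (4 * π ^ 2) with hρ_def
  have hρ : 0 < ρ := by positivity
  set F : ℝ[X] := C (1 / (2 * n ^ 2 : ℝ)) * ((Chebyshev.U ℝ ((n - 1 : ℕ) : ℤ)) ^ 2 * (1 + X))
    with hF_def
  have hF0 (t : ℝ) : 0 ≤ F.eval (cos t) := by
    have := neg_one_le_cos t
    have h : 0 ≤ 1 + cos t := by linarith
    simp only [hF_def, eval_mul, eval_C, eval_pow, eval_add, eval_one, eval_X]
    positivity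
  have hpred : ((n - 1 : ℕ) : ℝ) + 1 = n := by rw [Nat.cast_sub hn]; simp
  have hFeval (t : ℝ) : F.eval (cos t) * (4 * n ^ 2 * sin (t / 2) ^ 2) = sin (n * t) ^ 2 := by
    have hU := Chebyshev.U_real_cos t ((n - 1 : ℕ) : ℤ)
    rw [Int.cast_natCast, hpred] at hU
    have hs : sin t = 2 * sin (t / 2) * cos (t / 2) := by
      rw [← sin_two_mul]; ring_nf
    have hc : 1 + cos t = 2 * cos (t / 2) ^ 2 := by
      rw [cos_sq]; ring_nf
    simp only [hF_def, eval_mul, eval_C, eval_pow, eval_add, eval_one, eval_X]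
    rw [← hU, hc, hs]
    field_simp
    ring
  have hFupper (t : ℝ) (ht : |t| ≤ π) : F.eval (cos t) * t ^ 2 ≤ ρ * w ^ 2 := by
    have h1 : |t| / π ≤ |sin (t / 2)| := by
      have h := mul_abs_le_abs_sin (x := t / 2) (by rw [abs_div, abs_two]; linarith)
      rw [abs_div, abs_two] at h
      calc |t| / π = 2 / π * (|t| / 2) := by ring
        _ ≤ _ := h
    have h2 : t ^ 2 / π ^ 2 ≤ sin (t / 2) ^ 2 := by
      have := pow_le_pow_left₀ (by positivity) h1 2
      rwa [div_pow, sq_abs, sq_abs] at this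
    have h3 := mul_le_mul_of_nonneg_left h2 (mul_nonneg (hF0 t) (by positivity : 0 ≤ 4 * (n : ℝ) ^ 2))
    have h4 : F.eval (cos t) * (4 * n ^ 2) * (t ^ 2 / π ^ 2) ≤ 1 := by
      have := hFeval t
      have := sin_sq_le_one (n * t)
      linarith
    have h5 : F.eval (cos t) * t ^ 2 =
        F.eval (cos t) * (4 * n ^ 2) * (t ^ 2 / π ^ 2) * (ρ * w ^ 2) := by
      rw [hρ_def, hw_def]; field_simp
    rw [h5]
    exact mul_le_of_le_one_left (by positivity) h4
  have hFlower (t : ℝ) (ht : |t| ≤ π / (2 * n)) : 4 / π ^ 2 ≤ F.eval (cos t) := by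
    rcases eq_or_ne t 0 with rfl | h0
    · have h1 : F.eval (cos 0) = 1 := by
        simp only [hF_def, cos_zero, eval_mul, eval_C, eval_pow, eval_add, eval_one, eval_X,
          Chebyshev.U_eval_one]
        rw [Int.cast_natCast, hpred]
        field_simp
        norm_num
      rw [h1, div_le_one (by positivity)]
      nlinarith [pi_gt_three]
    · have h1 : 2 / π * (n * |t|) ≤ |sin (n * t)| := by
        have habs : |n * t| = n * |t| := by rw [abs_mul, abs_of_pos hn']
        have h := mul_abs_le_abs_sin (x := n * t) (by
          rw [habs]
          calc n * |t| ≤ n * (π / (2 * n)) := by gcongr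
            _ = π / 2 := by field_simp)
        rwa [habs] at h
      have h2 : 4 / π ^ 2 * (n ^ 2 * t ^ 2) ≤ sin (n * t) ^ 2 := by
        have := pow_le_pow_left₀ (by positivity) h1 2
        rw [sq_abs, mul_pow, mul_pow, div_pow, sq_abs] at this
        linarith
      have h3 : sin (t / 2) ^ 2 ≤ t ^ 2 / 4 := by
        have := sin_sq_le_sq (x := t / 2)
        linarith
      have h4 := mul_le_mul_of_nonneg_left h3
        (mul_nonneg (hF0 t) (by positivity : 0 ≤ 4 * (n : ℝ) ^ 2))
      have h5 : 4 / π ^ 2 * (n ^ 2 * t ^ 2) ≤ F.eval (cos t) * (n ^ 2 * t ^ 2) := by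
        have := hFeval t
        linarith
      exact le_of_mul_le_mul_right h5 (by positivity)
  have hdeg : F.natDegree ≤ 2 * n := by
    refine (natDegree_C_mul_le _ _).trans (natDegree_mul_le.trans ?_)
    have h1 : (1 + X : ℝ[X]).natDegree ≤ 1 := by compute_degree
    have h2 := natDegree_pow_le (p := Chebyshev.U ℝ ((n - 1 : ℕ) : ℤ)) (n := 2)
    rw [Chebyshev.natDegree_U_natCast] at h2
    omega
  have htail (t : ℝ) (ht : |t| ≤ π) (hwt : w < |t|) {k : ℕ} (hk : 1 ≤ k) :
      F.eval (cos t) ^ k ≤ 2 * ρ ^ k * w ^ 2 / (w ^ 2 + t ^ 2) := by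
    have hsq : w ^ 2 ≤ t ^ 2 := by
      have := pow_le_pow_left₀ hw.le hwt.le 2
      rwa [sq_abs] at this
    have ht2 : 0 < t ^ 2 := lt_of_lt_of_le (by positivity) hsq
    have h1 : F.eval (cos t) ≤ ρ * (w ^ 2 / t ^ 2) := by
      rw [← mul_div_assoc, le_div_iff₀ ht2]
      exact hFupper t ht
    calc F.eval (cos t) ^ k ≤ (ρ * (w ^ 2 / t ^ 2)) ^ k := pow_le_pow_left₀ (hF0 t) h1 k
      _ = ρ ^ k * (w ^ 2 / t ^ 2) ^ k := mul_pow _ _ _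
      _ ≤ ρ ^ k * (w ^ 2 / t ^ 2) := by
        gcongr
        exact pow_le_of_le_one (by positivity) ((div_le_one ht2).2 hsq) (by omega)
      _ ≤ ρ ^ k * (2 * w ^ 2 / (w ^ 2 + t ^ 2)) := by
        gcongr ρ ^ k * ?_
        rw [div_le_div_iff₀ ht2 (by positivity)]
        nlinarith
      _ = _ := by ring
  have hmass : π / n * (4 / π ^ 2) ^ m ≤ ∫ t in (-π)..π, F.eval (cos t) ^ m := by
    have hb : π / (2 * n) ≤ π := div_le_self hπ.le (by
      have : (1 : ℝ) ≤ n := by exact_mod_cast hn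
      linarith)
    have hb0 : 0 < π / (2 * n) := by positivity
    calc π / n * (4 / π ^ 2) ^ m
        = ∫ t in (-(π / (2 * n)))..(π / (2 * n)), (4 / π ^ 2) ^ m := by
          rw [integral_const, smul_eq_mul]; field_simp; norm_num
      _ ≤ ∫ t in (-(π / (2 * n)))..(π / (2 * n)), F.eval (cos t) ^ m := by
          refine integral_mono_on (by linarith) (by simp)
            (Continuous.intervalIntegrable (by fun_prop) _ _) fun t ht => ?_
          exact pow_le_pow_left₀ (by positivity) (hFlower t (abs_le.2 ht)) m
      _ ≤ ∫ t in (-π)..π, F.eval (cos t) ^ m := by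
          refine integral_mono_interval (by linarith) (by linarith) hb
            (Filter.Eventually.of_forall fun t => pow_nonneg (hF0 t) m)
            (Continuous.intervalIntegrable (by fun_prop) _ _)
  refine ⟨F ^ m, fun t => 2 * ρ ^ m * w ^ 2 / (w ^ 2 + t ^ 2), ?_, ?_, ?_, ?_, ?_, ?_, ?_, ?_⟩
  · refine natDegree_pow_le.trans ?_
    rw [mul_comm]
    gcongr
  · exact Continuous.div (by fun_prop) (by fun_prop) fun t => by positivity
  · intro t
    rw [eval_pow]
    exact pow_nonneg (hF0 t) m
  · intro t
    positivity
  · intro t ht hwt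
    rw [eval_pow]
    exact htail t ht hwt (by omega)
  · intro t ht hwt
    obtain ⟨k, rfl⟩ : ∃ k, m = k + 1 := ⟨m - 1, by omega⟩
    rw [eval_pow]
    calc F.eval (cos t) ^ (k + 1) * t ^ 2
        = F.eval (cos t) ^ k * (F.eval (cos t) * t ^ 2) := by ring
      _ ≤ 2 * ρ ^ k * w ^ 2 / (w ^ 2 + t ^ 2) * (ρ * w ^ 2) :=
        mul_le_mul (htail t ht hwt (by omega)) (hFupper t ht)
          (mul_nonneg (hF0 t) (sq_nonneg t)) (by positivity)
      _ = _ := by ring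
  · simp only [eval_pow]
    exact lt_of_lt_of_le (by positivity) hmass
  · simp only [eval_pow]
    calc ∫ t in (-π)..π, 2 * ρ ^ m * w ^ 2 / (w ^ 2 + t ^ 2)
        = 2 * ρ ^ m * ∫ t in (-π)..π, w ^ 2 / (w ^ 2 + t ^ 2) := by
          rw [← integral_const_mul]; simp only [mul_div_assoc]
      _ ≤ 2 * ρ ^ m * (π * w) := by
          gcongr
          exact integral_sq_div_sq_add_sq_le hw _ _
      _ = 2 * π ^ 2 / 16 ^ m * (π / n * (4 / π ^ 2) ^ m) := by
          have h : ρ = 4 / π ^ 2 / 16 := by rw [hρ_def]; ring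
          rw [h, hw_def, div_pow _ (16 : ℝ)]
          ring
      _ ≤ _ := by gcongr

open Real intervalIntegral in
theorem integral_mul_one_sub_cos_le {K T : ℝ → ℝ} {w : ℝ} (hK : Continuous K)
    (hT : Continuous T) (hK0 : ∀ t, 0 ≤ K t) (hT0 : ∀ t, 0 ≤ T t)
    (htail : ∀ t, |t| ≤ π → w < |t| → K t * t ^ 2 ≤ w ^ 2 * T t) :
    ∫ t in (-π)..π, K t * (1 - cos t) ≤
      w ^ 2 / 2 * ((∫ t in (-π)..π, K t) + ∫ t in (-π)..π, T t) := by
  rw [← integral_add (hK.intervalIntegrable _ _) (hT.intervalIntegrable _ _), ← integral_const_mul]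
  refine integral_mono_on (by linarith [pi_pos])
    (Continuous.intervalIntegrable (by fun_prop) _ _)
    (Continuous.intervalIntegrable (by fun_prop) _ _) fun t ht => ?_
  have hcos : 1 - cos t ≤ t ^ 2 / 2 := by linarith [one_sub_sq_div_two_le_cos (x := t)]
  have h := mul_le_mul_of_nonneg_left hcos (hK0 t)
  rcases le_or_gt |t| w with hw | hw
  · have hsq : t ^ 2 ≤ w ^ 2 := sq_le_sq.2 (hw.trans (le_abs_self w))
    have h1 := mul_le_mul_of_nonneg_left hsq (hK0 t)
    have h2 := mul_nonneg (sq_nonneg w) (hT0 t)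
    linarith
  · have h1 := htail t (abs_le.2 ht) hw
    have h2 := mul_nonneg (sq_nonneg w) (hK0 t)
    linarith

/-- The truncation error `max (-1) (min 1 y) - y` is `1`-Lipschitz. -/
theorem abs_clamp_sub_self_sub_le (y z : ℝ) :
    |(max (-1) (min 1 y) - y) - (max (-1) (min 1 z) - z)| ≤ |y - z| := by
  rw [abs_le]
  constructor <;> rcases abs_cases (y - z) with h | h <;>
    rcases max_cases (-1) (min 1 y) with h1 | h1 <;> rcases min_cases 1 y with h2 | h2 <;>
    rcases max_cases (-1) (min 1 z) with h3 | h3 <;> rcases min_cases 1 z with h4 | h4 <;>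
    linarith

theorem clamp_eq_self {y : ℝ} (hy : |y| ≤ 1) : max (-1) (min 1 y) = y := by
  rw [min_eq_right (abs_le.1 hy).2, max_eq_right (abs_le.1 hy).1]

theorem abs_clamp_le_one (y : ℝ) : |max (-1) (min 1 y)| ≤ 1 :=
  abs_le.2 ⟨le_max_left _ _, max_le (by norm_num) (min_le_left _ _)⟩

theorem clamp_neg (y : ℝ) : max (-1) (min 1 (-y)) = -max (-1) (min 1 y) := by
  rcases max_cases (-1) (min 1 y) with h1 | h1 <;> rcases min_cases 1 y with h2 | h2 <;>
    rcases max_cases (-1) (min 1 (-y)) with h3 | h3 <;> rcases min_cases 1 (-y) with h4 | h4 <;>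
    linarith

open Real intervalIntegral in
/-- Convolving the truncation of `A sin` with an even kernel `K` multiplies `A sin` by
`∫ K cos` near the origin, up to a relative error controlled by the tails of `K`. -/
theorem abs_convolution_clamp_sin_sub_le {K T : ℝ → ℝ} {w A s : ℝ} (hK : Continuous K)
    (hT : Continuous T) (hK0 : ∀ t, 0 ≤ K t) (hT0 : ∀ t, 0 ≤ T t) (hKeven : ∀ t, K (-t) = K t)
    (htail : ∀ t, |t| ≤ π → w < |t| → K t ≤ T t) (hA : 0 ≤ A)
    (hAs : A * (|sin s| + w) ≤ 1) :
    |(∫ t in (-π)..π, K t * max (-1) (min 1 (A * sin (s + t)))) -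
        A * (∫ t in (-π)..π, K t * cos t) * sin s| ≤ A * |s| * ∫ t in (-π)..π, T t := by
  have odd_integral {f : ℝ → ℝ} (hf : ∀ t, f (-t) = -f t) : ∫ t in (-π)..π, f t = 0 := by
    have h := integral_comp_neg (a := -π) (b := π) f
    simp only [hf, integral_neg, neg_neg] at h
    linarith
  set h : ℝ → ℝ := fun u => max (-1) (min 1 (A * sin u)) - A * sin u with h_def
  have hcont : Continuous h := by fun_prop
  have hodd : ∫ t in (-π)..π, K t * h t = 0 := odd_integral fun t => by
    simp only [h_def, hKeven, sin_neg, mul_neg, clamp_neg]; ring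
  have hodd' : ∫ t in (-π)..π, K t * sin t = 0 := odd_integral fun t => by
    simp only [hKeven, sin_neg, mul_neg]
  have hmain : (∫ t in (-π)..π, K t * max (-1) (min 1 (A * sin (s + t)))) -
      A * (∫ t in (-π)..π, K t * cos t) * sin s =
        ∫ t in (-π)..π, K t * (h (s + t) - h t) := by
    have hsplit (t : ℝ) : K t * (h (s + t) - h t) =
        K t * max (-1) (min 1 (A * sin (s + t))) - (A * sin s * (K t * cos t) +
          A * cos s * (K t * sin t)) - K t * h t := by
      simp only [h_def, sin_add]; ring
    simp only [hsplit]
    rw [integral_sub (Continuous.intervalIntegrable (by fun_prop) _ _)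
        (Continuous.intervalIntegrable (by fun_prop) _ _),
      integral_sub (Continuous.intervalIntegrable (by fun_prop) _ _)
        (Continuous.intervalIntegrable (by fun_prop) _ _),
      integral_add (Continuous.intervalIntegrable (by fun_prop) _ _)
        (Continuous.intervalIntegrable (by fun_prop) _ _),
      integral_const_mul, integral_const_mul, hodd, hodd']
    ring
  rw [hmain, ← integral_const_mul]
  refine (abs_integral_le_integral_abs (by linarith [pi_pos])).trans ?_
  refine integral_mono_on (by linarith [pi_pos])
    (Continuous.intervalIntegrable (by fun_prop) _ _)
    (Continuous.intervalIntegrable (by fun_prop) _ _) fun t ht => ?_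
  rw [abs_mul, abs_of_nonneg (hK0 t)]
  rcases le_or_gt |t| w with hw | hw
  · have hzero {u : ℝ} (hu : |sin u| ≤ |sin s| + w) : h u = 0 := by
      have hle : |A * sin u| ≤ 1 := by
        rw [abs_mul, abs_of_nonneg hA]
        exact (mul_le_mul_of_nonneg_left hu hA).trans hAs
      simp only [h_def, clamp_eq_self hle, sub_self]
    have hsin : |sin t| ≤ w := abs_sin_le_abs.trans hw
    have hadd : |sin (s + t)| ≤ |sin s| + |sin t| := by
      rw [sin_add]
      refine (abs_add_le _ _).trans ?_
      rw [abs_mul, abs_mul]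
      exact add_le_add (mul_le_of_le_one_right (abs_nonneg _) (abs_cos_le_one _))
        (mul_le_of_le_one_left (abs_nonneg _) (abs_cos_le_one _))
    rw [hzero (by linarith), hzero (by linarith [abs_nonneg (sin s)]), sub_self, abs_zero, mul_zero]
    have := hT0 t
    positivity
  · have hlip : |h (s + t) - h t| ≤ A * |s| := by
      refine (abs_clamp_sub_self_sub_le _ _).trans ?_
      rw [← mul_sub, abs_mul, abs_of_nonneg hA]
      exact mul_le_mul_of_nonneg_left (by simpa using abs_sin_sub_sin_le (s + t) t) hA
    rw [mul_comm]
    exact mul_le_mul hlip (htail t (abs_le.2 ht) hw) (hK0 t) (by positivity)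

open Polynomial in
/-- Passing to the odd part of a polynomial preserves its bounds and its distance to `c * x`. -/
theorem exists_odd_polynomial_of_bounds {Q : ℝ[X]} {B c r e : ℝ}
    (hB : ∀ x ∈ Set.Icc (-1 : ℝ) 1, |Q.eval x| ≤ B)
    (he : ∀ x ∈ Set.Icc (-r) r, |Q.eval x - c * x| ≤ e) :
    ∃ R : ℝ[X], (∀ x, R.eval (-x) = -R.eval x) ∧ R.natDegree ≤ Q.natDegree ∧
      (∀ x ∈ Set.Icc (-1 : ℝ) 1, |R.eval x| ≤ B) ∧
      ∀ x ∈ Set.Icc (-r) r, |R.eval x - c * x| ≤ e := by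
  have heval (x : ℝ) : (C (1 / 2) * (Q - Q.comp (-X))).eval x = (Q.eval x - Q.eval (-x)) / 2 := by
    simp; ring
  refine ⟨C (1 / 2) * (Q - Q.comp (-X)), fun x => ?_, ?_, fun x hx => ?_, fun x hx => ?_⟩
  · rw [heval, heval, neg_neg]; ring
  · refine (natDegree_C_mul_le _ _).trans ((natDegree_sub_le _ _).trans (max_le le_rfl ?_))
    rw [natDegree_comp, natDegree_neg, natDegree_X, mul_one]
  · have h1 := abs_le.1 (hB x hx)
    have h2 := abs_le.1 (hB (-x) ⟨by linarith [hx.2], by linarith [hx.1]⟩)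
    rw [heval, abs_le]
    constructor <;> linarith [h1.1, h1.2, h2.1, h2.2]
  · have h1 := abs_le.1 (he x hx)
    have h2 := abs_le.1 (he (-x) ⟨by linarith [hx.2], by linarith [hx.1]⟩)
    rw [heval, abs_le]
    constructor <;> linarith [h1.1, h1.2, h2.1, h2.2]

open Polynomial Real intervalIntegral in
/-- The approximation bound in terms of the parameters `n`, `m` of the Jackson-type kernel. -/
theorem exists_polynomial_approx_linear {n m : ℕ} {α β ε : ℝ} (hn : 0 < n) (hm : 2 ≤ m)
    (hβ : 1 < β) (hαβ : β < α) (hw : π ^ 2 / n ≤ (β - 1) / (2 * α)) (hε : ε ≤ 1)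
    (hτ : 2 * π ^ 2 / 16 ^ m ≤ ε / 3) :
    ∃ Q : ℝ[X], Q.natDegree ≤ 2 * n * m ∧ (∀ x ∈ Set.Icc (-1 : ℝ) 1, |Q.eval x| ≤ 1) ∧
      ∀ x ∈ Set.Icc (-(1 / α)) (1 / α), |Q.eval x - (α / β) * x| ≤ ε / β := by
  obtain ⟨P, T, hdeg, hT, hP0, hT0, htail, htail2, hM, hTM⟩ := exists_jackson_kernel hn hm
  have hπ := pi_pos
  have hβ0 : 0 < β := by linarith
  have hα0 : 0 < α := by linarith
  have hn' : (0 : ℝ) < n := by exact_mod_cast hn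
  have hw0 : 0 < π ^ 2 / n := by positivity
  have hτ0 : 0 < 2 * π ^ 2 / 16 ^ m := by positivity
  have hε0 : 0 < ε := by linarith
  generalize π ^ 2 / (n : ℝ) = w at *
  generalize 2 * π ^ 2 / (16 : ℝ) ^ m = τ at *
  have hK : Continuous fun t => P.eval (cos t) := by fun_prop
  set M := ∫ t in (-π)..π, P.eval (cos t) with M_def
  set L := ∫ t in (-π)..π, P.eval (cos t) * cos t with L_def
  have hαw : α * w ≤ (β - 1) / 2 := by
    calc α * w ≤ α * ((β - 1) / (2 * α)) := by gcongr
      _ = (β - 1) / 2 := by field_simp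
  have hw_half : w ≤ 1 / 2 := hw.trans (by rw [div_le_iff₀ (by positivity)]; linarith)
  have hML : M - L ≤ w ^ 2 * M := by
    have h := integral_mul_one_sub_cos_le hK hT hP0 hT0 htail2
    have h1 : ∫ t in (-π)..π, P.eval (cos t) * (1 - cos t) = M - L := by
      rw [M_def, L_def, ← integral_sub (hK.intervalIntegrable _ _)
        (Continuous.intervalIntegrable (by fun_prop) _ _)]
      simp only [mul_sub, mul_one]
    rw [h1] at h
    have h2 : ∫ t in (-π)..π, T t ≤ M :=
      hTM.trans (mul_le_of_le_one_left hM.le (by linarith))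
    have h3 : w ^ 2 / 2 * (M + ∫ t in (-π)..π, T t) ≤ w ^ 2 / 2 * (M + M) := by gcongr
    linarith
  have hL_lower : 3 / 4 * M ≤ L := by
    have : w ^ 2 * M ≤ 1 / 4 * M := by
      gcongr
      nlinarith
    linarith
  have hL : 0 < L := by linarith
  set A := α * M / (β * L) with A_def
  have hA : 0 < A := by positivity
  have hAL : A * L / M = α / β := by rw [A_def]; field_simp
  have hAw : A * (1 / α + w) ≤ 1 := by
    have h1 : β * w ^ 2 + α * w ≤ β - 1 := by
      have : β * w ≤ α * w := by gcongr
      nlinarith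
    have h2 : M * (1 + α * w) ≤ M * (β - β * w ^ 2) := by
      gcongr
      linarith
    have h3 : A * (1 / α + w) = M * (1 + α * w) / (β * L) := by rw [A_def]; field_simp
    rw [h3, div_le_one (by positivity)]
    nlinarith [mul_le_mul_of_nonneg_left hML hβ0.le]
  obtain ⟨Q, hQdeg, hQ⟩ := exists_polynomial_eval_cos_eq_convolution P
    (g := fun y => max (-1) (min 1 (A * y))) (by fun_prop)
  have hQeval {x : ℝ} (hx : x ∈ Set.Icc (-1 : ℝ) 1) : (C (1 / M) * Q).eval x =
      1 / M * ∫ t in (-π)..π, P.eval (cos t) * max (-1) (min 1 (A * sin (arcsin x + t))) := by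
    have h := hQ (π / 2 - arcsin x)
    rw [cos_pi_div_two_sub, sin_arcsin hx.1 hx.2] at h
    rw [eval_C_mul, h]
    simp only [sub_sub, cos_pi_div_two_sub]
  refine ⟨C (1 / M) * Q, (natDegree_C_mul_le _ _).trans (hQdeg.trans hdeg), fun x hx => ?_,
    fun x hx => ?_⟩
  · rw [hQeval hx, abs_mul, abs_of_pos (by positivity), one_div_mul_eq_div, div_le_one hM]
    refine (abs_integral_le_integral_abs (by linarith)).trans ?_
    refine integral_mono_on (by linarith) (Continuous.intervalIntegrable (by fun_prop) _ _)
      (hK.intervalIntegrable _ _) fun t _ => ?_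
    rw [abs_mul, abs_of_nonneg (hP0 t)]
    exact mul_le_of_le_one_right (hP0 t) (abs_clamp_le_one _)
  · have hα1 : 1 / α ≤ 1 := by rw [div_le_one hα0]; linarith
    have hx1 : x ∈ Set.Icc (-1 : ℝ) 1 := ⟨by linarith [hx.1], by linarith [hx.2]⟩
    have hsin : sin (arcsin x) = x := sin_arcsin hx1.1 hx1.2
    have hxα : |x| ≤ 1 / α := abs_le.2 hx
    have harcsin : |arcsin x| ≤ π / 2 * |x| := by
      have h := mul_abs_le_abs_sin (x := arcsin x)
        (abs_le.2 ⟨neg_pi_div_two_le_arcsin x, arcsin_le_pi_div_two x⟩)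
      rw [hsin] at h
      calc |arcsin x| = π / 2 * (2 / π * |arcsin x|) := by field_simp
        _ ≤ _ := by gcongr
    have h := abs_convolution_clamp_sin_sub_le (s := arcsin x) hK hT hP0 hT0
      (fun t => by rw [cos_neg]) htail hA.le (by
        rw [hsin]
        exact le_trans (by gcongr) hAw)
    rw [hsin] at h
    have hdiff : (C (1 / M) * Q).eval x - α / β * x = 1 / M *
        ((∫ t in (-π)..π, P.eval (cos t) * max (-1) (min 1 (A * sin (arcsin x + t)))) -
          A * L * x) := by
      rw [hQeval hx1, ← hAL]; ring
    rw [hdiff, abs_mul, abs_of_pos (by positivity)]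
    calc _ ≤ 1 / M * (A * |arcsin x| * ∫ t in (-π)..π, T t) := by gcongr
      _ ≤ 1 / M * (A * (π / 2 * (1 / α)) * (ε / 3 * M)) := by
        have h1 : ∫ t in (-π)..π, T t ≤ ε / 3 * M := hTM.trans (by gcongr)
        have h2 : |arcsin x| ≤ π / 2 * (1 / α) := harcsin.trans (by gcongr)
        have h3 : 0 ≤ ∫ t in (-π)..π, T t := integral_nonneg (by linarith) fun t _ => hT0 t
        gcongr
      _ = ε / β * (π / 6 * M / L) := by rw [A_def]; field_simp; norm_num
      _ ≤ ε / β := by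
        refine mul_le_of_le_one_right (by positivity) ?_
        rw [div_le_one hL]
        nlinarith [pi_lt_four]


/-- **Polynomial for up-scaling block-encoded operators.**
There is a constant `C > 0` such that for all `1 < β < α` and `ε' ∈ (0, 1/2)` there is an
odd real polynomial `R` of degree at most `C·(α/(β − 1))·(1 + ln(1/ε'))` with `|R(x)| ≤ 1`
on `[−1, 1]` and `|R(x) − (α/β)x| ≤ ε'/β` on `[−1/α, 1/α]`. -/
theorem up_scaling_polynomial :
    ∃ C : ℝ, 0 < C ∧
      ∀ α β : ℝ, 1 < β → β < α →
        ∀ ε' : ℝ, 0 < ε' → ε' < 1 / 2 →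
          ∃ R : Polynomial ℝ,
            (∀ x : ℝ, R.eval (-x) = -R.eval x) ∧
            (R.natDegree : ℝ) ≤ C * (α / (β - 1)) * (1 + Real.log (1 / ε')) ∧
            (∀ x ∈ Set.Icc (-1 : ℝ) 1, |R.eval x| ≤ 1) ∧
            (∀ x ∈ Set.Icc (-(1 / α)) (1 / α), |R.eval x - (α / β) * x| ≤ ε' / β) := by
  refine ⟨6 * (2 * Real.pi ^ 2 + 1), by positivity, fun α β hβ hαβ ε hε0 hε => ?_⟩
  have hδ : 0 < β - 1 := by linarith
  have hα0 : 0 < α := by linarith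
  have hratio : 1 ≤ α / (β - 1) := by rw [one_le_div hδ]; linarith
  have hlog : 0 ≤ Real.log (1 / ε) := Real.log_nonneg (by rw [le_div_iff₀ hε0]; linarith)
  obtain ⟨n, hn_def⟩ : ∃ n, n = ⌈2 * Real.pi ^ 2 * (α / (β - 1))⌉₊ := ⟨_, rfl⟩
  obtain ⟨k, hk_def⟩ : ∃ k, k = ⌈Real.log (1 / ε)⌉₊ := ⟨_, rfl⟩
  have hn_lower : 2 * Real.pi ^ 2 * (α / (β - 1)) ≤ n := hn_def ▸ Nat.le_ceil _
  have hn_upper : (n : ℝ) ≤ 2 * Real.pi ^ 2 * (α / (β - 1)) + 1 :=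
    hn_def ▸ (Nat.ceil_lt_add_one (by positivity)).le
  have hk_lower : Real.log (1 / ε) ≤ k := hk_def ▸ Nat.le_ceil _
  have hk_upper : (k : ℝ) ≤ Real.log (1 / ε) + 1 := hk_def ▸ (Nat.ceil_lt_add_one hlog).le
  have hn0 : (0 : ℝ) < n := lt_of_lt_of_le (by positivity) hn_lower
  have hw : Real.pi ^ 2 / n ≤ (β - 1) / (2 * α) := by
    rw [div_le_div_iff₀ hn0 (by positivity)]
    calc Real.pi ^ 2 * (2 * α) = (β - 1) * (2 * Real.pi ^ 2 * (α / (β - 1))) := by field_simp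
      _ ≤ _ := by gcongr
  have hτ : 2 * Real.pi ^ 2 / 16 ^ (k + 2) ≤ ε / 3 := by
    have h1 : 1 / ε ≤ 16 ^ k := by
      calc 1 / ε = Real.exp (Real.log (1 / ε)) := (Real.exp_log (by positivity)).symm
        _ ≤ Real.exp k := Real.exp_le_exp.2 hk_lower
        _ = Real.exp 1 ^ k := by rw [← Real.exp_nat_mul, mul_one]
        _ ≤ 16 ^ k := by gcongr; linarith [Real.exp_one_lt_d9]
    rw [div_le_iff₀ hε0] at h1
    rw [div_le_div_iff₀ (by positivity) (by norm_num), pow_add]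
    nlinarith [Real.pi_lt_four, Real.pi_pos]
  obtain ⟨Q, hdeg, hB, he⟩ := exists_polynomial_approx_linear (by exact_mod_cast hn0)
    (by omega : 2 ≤ k + 2) hβ hαβ hw (by linarith) hτ
  obtain ⟨R, hodd, hRdeg, hRB, hRe⟩ := exists_odd_polynomial_of_bounds hB he
  refine ⟨R, hodd, ?_, hRB, hRe⟩
  calc (R.natDegree : ℝ) ≤ 2 * n * (k + 2) := by exact_mod_cast hRdeg.trans hdeg
    _ ≤ 2 * ((2 * Real.pi ^ 2 + 1) * (α / (β - 1))) * (3 * (1 + Real.log (1 / ε))) := by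
      gcongr <;> linarith
    _ = _ := by ring
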